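/- In the counterexample market with parameter n, there exists n₀ ∈ ℕ such that for every n ≥ n₀: every spread-valued adapted process S̃ with J(S̃) = J must satisfy S̃_0 = 3, S̃_1 = 2 a.s., and S̃_2 = S̄_2 a.s. (the candidate shadow price must coincide with the ask price at purchases and with the bid price at sales of the optimal strategy). -/

import Mathlib

open MeasureTheory ENNReal Filter

noncomputable section

/-- Sample space of the counterexample market: first coordinate `k ∈ ℕ`,
second coordinate the Bernoulli outcome at time 2 (`true` = ask price jumps up). -/
abbrev Omega : Type := ℕ × Bool

/-- `q n k = 2^{-(n+k)}` as an extended nonnegative real. -/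
def q (n k : ℕ) : ℝ≥0∞ := (2 : ℝ≥0∞)⁻¹ ^ (n + k)

/-- The first-coordinate probabilities: `p 0 = 1 - 2^{-n}`, `p k = 2^{-(n+k)}` for `k ≥ 1`. -/
def pk (n : ℕ) (k : ℕ) : ℝ≥0∞ := if k = 0 then 1 - (2 : ℝ≥0∞)⁻¹ ^ n else (2 : ℝ≥0∞)⁻¹ ^ (n + k)

/-- The weight of each atom `(k, j)` of the counterexample market. -/
def w (n : ℕ) : Omega → ℝ≥0∞
  | (k, true) => pk n k * q n k
  | (k, false) => pk n k * (1 - q n k)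

/-- The probability measure of the counterexample market with parameter `n`. -/
def P (n : ℕ) : Measure Omega := Measure.sum (fun ω => w n ω • Measure.dirac ω)

/-- Ask price of the risky asset at time 1 in the state with first coordinate `k`. -/
def ask1 (k : ℕ) : ℝ := 2 + k

/-- Ask price of the risky asset at time 2. -/
def ask2 : Omega → ℝ
  | (k, true) => 3 + k
  | (_, false) => 1

/-- A (trading) strategy, given by holdings in the safe asset (`a`) and the risky asset (`b`)
at times `0,1,2`; adaptedness to the filtration (trivial at time 0, generated by the first
coordinate at time 1, everything at time 2) is encoded by the arguments of the functions. -/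
structure Strat where
  a0 : ℝ
  b0 : ℝ
  a1 : ℕ → ℝ
  b1 : ℕ → ℝ
  a2 : Omega → ℝ
  b2 : Omega → ℝ

/-- Self-financing condition with transaction costs, from pre-trade initial position
`(x0, y0)`: purchases are made at the ask price, sales at the bid price. -/
def SelfFinancingTC (x0 y0 : ℝ) (φ : Strat) : Prop :=
  (φ.a0 - x0 ≤ -(max (φ.b0 - y0) 0) * 3 + max (y0 - φ.b0) 0 * 3) ∧
  (∀ k : ℕ, φ.a1 k - φ.a0 ≤ -(max (φ.b1 k - φ.b0) 0) * ask1 k + max (φ.b0 - φ.b1 k) 0 * 2) ∧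
  (∀ ω : Omega,
    φ.a2 ω - φ.a1 ω.1 ≤ -(max (φ.b2 ω - φ.b1 ω.1) 0) * ask2 ω + max (φ.b1 ω.1 - φ.b2 ω) 0 * 1)

/-- An adapted (to the filtration of the counterexample market) real-valued price process. -/
structure PriceProc where
  s0 : ℝ
  s1 : ℕ → ℝ
  s2 : Omega → ℝ

/-- A price process valued in the bid-ask spread `[S̲, S̄]`. -/
def SpreadValued (S : PriceProc) : Prop :=
  S.s0 = 3 ∧ (∀ k : ℕ, 2 ≤ S.s1 k ∧ S.s1 k ≤ ask1 k) ∧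
    (∀ ω : Omega, 1 ≤ S.s2 ω ∧ S.s2 ω ≤ ask2 ω)

/-- Frictionless self-financing condition for the price process `S`, from pre-trade
initial position `(x0, y0)`. -/
def SelfFinancingFL (x0 y0 : ℝ) (S : PriceProc) (φ : Strat) : Prop :=
  (φ.a0 - x0 = -(φ.b0 - y0) * S.s0) ∧
  (∀ k : ℕ, φ.a1 k - φ.a0 = -(φ.b1 k - φ.b0) * S.s1 k) ∧
  (∀ ω : Omega, φ.a2 ω - φ.a1 ω.1 = -(φ.b2 ω - φ.b1 ω.1) * S.s2 ω)

/-- Expected logarithmic utility `E[log f]`, with values in the extended reals. -/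
def elog (μ : Measure Omega) (f : Omega → ℝ) : EReal :=
  ((∫⁻ ω, ENNReal.ofReal (Real.log (f ω)) ∂μ : ℝ≥0∞) : EReal) -
    ((∫⁻ ω, ENNReal.ofReal (-Real.log (f ω)) ∂μ : ℝ≥0∞) : EReal)

/-- Admissibility for the transaction-cost problem with pre-trade initial position `(4, -1)`:
self-financing, liquidating, with strictly positive terminal wealth a.s. -/
def AdmissibleTC (n : ℕ) (φ : Strat) : Prop :=
  SelfFinancingTC 4 (-1) φ ∧ (∀ ω : Omega, φ.b2 ω = 0) ∧ (∀ᵐ ω ∂(P n), 0 < φ.a2 ω)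

/-- The value `J` of the transaction-cost utility maximization problem. -/
def JTC (n : ℕ) : EReal :=
  sSup {x : EReal | ∃ φ : Strat, AdmissibleTC n φ ∧ x = elog (P n) φ.a2}

/-- Admissibility for the frictionless problem for `S` with pre-trade initial position `(4, -1)`. -/
def AdmissibleFL (n : ℕ) (S : PriceProc) (φ : Strat) : Prop :=
  SelfFinancingFL 4 (-1) S φ ∧ (∀ ω : Omega, φ.b2 ω = 0) ∧ (∀ᵐ ω ∂(P n), 0 < φ.a2 ω)

/-- The value `J(S̃)` of the frictionless utility maximization problem for the price process `S̃`. -/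
def JFL (n : ℕ) (S : PriceProc) : EReal :=
  sSup {x : EReal | ∃ φ : Strat, AdmissibleFL n S φ ∧ x = elog (P n) φ.a2}

end

/-- The integral against `P n` is the sum, over the first coordinate, of the weighted values. -/
lemma lintegral_P (n : ℕ) (f : Omega → ℝ≥0∞) :
    ∫⁻ ω, f ω ∂(P n) =
      ∑' k, pk n k * (q n k * f (k, true) + (1 - q n k) * f (k, false)) := by
  have h : ∫⁻ ω, f ω ∂(P n) = ∑' ω, w n ω * f ω := by
    simp [P, lintegral_sum_measure, lintegral_smul_measure]
  rw [h, ENNReal.tsum_prod (f := fun k j => w n (k, j) * f (k, j))]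
  refine tsum_congr fun k => ?_
  rw [tsum_bool]
  simp only [w]
  ring

lemma q_eq_ofReal (n k : ℕ) : q n k = ENNReal.ofReal ((2 : ℝ)⁻¹ ^ (n + k)) := by
  rw [q, ENNReal.ofReal_pow (by norm_num), ENNReal.ofReal_inv_of_pos (by norm_num)]
  simp

lemma one_sub_q_eq_ofReal (n k : ℕ) :
    1 - q n k = ENNReal.ofReal (1 - (2 : ℝ)⁻¹ ^ (n + k)) := by
  rw [q_eq_ofReal, ENNReal.ofReal_sub _ (by positivity), ENNReal.ofReal_one]

lemma inv_two_pow_mul_lt_one {n : ℕ} (hn : 2 ≤ n) (k : ℕ) :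
    (2 : ℝ)⁻¹ ^ (n + k) * (2 + k) < 1 := by
  have h1 : (2 + k : ℝ) < 2 ^ (n + k) := by
    have : 2 + k < 2 ^ (n + k) := (Nat.lt_two_pow_self).trans_le
      (Nat.pow_le_pow_right (by norm_num) (by omega))
    exact_mod_cast this
  rw [inv_pow, inv_mul_lt_iff₀ (by positivity)]
  linarith

lemma pk_ne_zero {n : ℕ} (hn : 1 ≤ n) (k : ℕ) : pk n k ≠ 0 := by
  unfold pk
  split_ifs
  · rw [← ENNReal.inv_pow]
    refine (tsub_pos_of_lt ?_).ne'
    rw [ENNReal.inv_lt_one]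
    exact one_lt_pow₀ (by norm_num) (by omega)
  · simp

lemma tsum_pk_ne_top (n : ℕ) : ∑' k, pk n k ≠ ∞ := by
  have h : ∀ k, pk n k ≤ (2 : ℝ≥0∞)⁻¹ ^ k := by
    intro k
    unfold pk
    split_ifs with hk
    · simp [hk]
    · exact pow_le_pow_right_of_le_one' (by simp) (by omega)
  refine ne_top_of_le_ne_top ?_ (ENNReal.tsum_le_tsum h)
  rw [ENNReal.tsum_geometric]
  simp

lemma inv_two_pow_lt_one {n : ℕ} (hn : 1 ≤ n) (k : ℕ) : (2 : ℝ)⁻¹ ^ (n + k) < 1 :=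
  pow_lt_one₀ (by norm_num) (by norm_num) (by omega)

lemma w_ne_zero {n : ℕ} (hn : 1 ≤ n) (ω : Omega) : w n ω ≠ 0 := by
  obtain ⟨k, j⟩ := ω
  have := inv_two_pow_lt_one hn k
  cases j
  · simp only [w, one_sub_q_eq_ofReal]
    exact mul_ne_zero (pk_ne_zero hn k) (by simpa using this)
  · simp only [w, q_eq_ofReal]
    refine mul_ne_zero (pk_ne_zero hn k) ?_
    simp

lemma ae_P_iff {n : ℕ} (hn : 1 ≤ n) (p : Omega → Prop) : (∀ᵐ ω ∂(P n), p ω) ↔ ∀ ω, p ω := by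
  rw [P, Measure.ae_sum_iff]
  refine forall_congr' fun ω => ?_
  rw [Measure.ae_ennreal_smul_measure_iff (w_ne_zero hn ω), ae_dirac_eq]
  rfl

lemma EReal.coe_sub_coe_le_iff (a b : ℝ≥0∞) {c d : ℝ≥0∞} (hc : c ≠ ∞) (hd : d ≠ ∞) :
    (a : EReal) - b ≤ (c : EReal) - d ↔ a + d ≤ c + b := by
  lift c to NNReal using hc
  lift d to NNReal using hd
  induction b with
  | top => simp [sub_eq_add_neg]
  | coe b =>
    induction a with
    | top =>
      have h1 : ¬ ((⊤ : EReal) - ((b : ℝ) : EReal) ≤ ((c : ℝ) : EReal) - ((d : ℝ) : EReal)) := by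
        rw [EReal.top_sub_coe, top_le_iff, ← EReal.coe_sub]
        exact EReal.coe_ne_top _
      have h2 : ¬ (∞ + (d : ℝ≥0∞) ≤ (c : ℝ≥0∞) + b) := by
        rw [top_add, top_le_iff, ← ENNReal.coe_add]
        exact ENNReal.coe_ne_top
      exact iff_of_false h1 h2
    | coe a =>
      have h1 : ((a : ℝ) : EReal) - ((b : ℝ) : EReal) ≤ ((c : ℝ) : EReal) - ((d : ℝ) : EReal) ↔
          (a : ℝ) - b ≤ c - d := by
        rw [← EReal.coe_sub, ← EReal.coe_sub, EReal.coe_le_coe_iff]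
      refine h1.trans ?_
      rw [← ENNReal.coe_add, ← ENNReal.coe_add, ENNReal.coe_le_coe, ← NNReal.coe_le_coe]
      push_cast
      constructor <;> intro h <;> linarith

/-- Number of shares sold short at time 1 by the optimal strategy. -/
noncomputable def shortSale (n k : ℕ) : ℝ := (1 - (2 : ℝ)⁻¹ ^ (n + k) * (2 + k)) / (1 + k)

/-- Terminal wealth when one unit of cash is held at time 0 and `shortSale n k` shares are sold
short at time 1, for the price process `S`. -/
noncomputable def shortWealth (n : ℕ) (S : PriceProc) (ω : Omega) : ℝ :=
  1 + shortSale n ω.1 * (S.s1 ω.1 - S.s2 ω)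

/-- The price process that is at the bid price at time 1 and at the ask price at time 2. -/
def shadow : PriceProc where
  s0 := 3
  s1 _ := 2
  s2 := ask2

lemma shortSale_pos {n : ℕ} (hn : 2 ≤ n) (k : ℕ) : 0 < shortSale n k :=
  div_pos (by linarith [inv_two_pow_mul_lt_one hn k]) (by positivity)

lemma shortSale_le_one (n k : ℕ) : shortSale n k ≤ 1 := by
  rw [shortSale, div_le_one (by positivity)]
  have h : 0 ≤ (2 : ℝ)⁻¹ ^ (n + k) * (2 + k) := by positivity
  have h' : (0 : ℝ) ≤ k := by positivity
  linarith

lemma shortWealth_shadow_true (n k : ℕ) :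
    shortWealth n shadow (k, true) = (2 : ℝ)⁻¹ ^ (n + k) * (2 + k) := by
  have : (1 + k : ℝ) ≠ 0 := by positivity
  simp only [shortWealth, shortSale, shadow, ask2]
  field_simp
  ring

lemma shortWealth_shadow_false (n k : ℕ) :
    shortWealth n shadow (k, false) = 1 + shortSale n k := by
  simp only [shortWealth, shadow, ask2]
  ring

lemma shortWealth_shadow_pos {n : ℕ} (hn : 2 ≤ n) (ω : Omega) :
    0 < shortWealth n shadow ω := by
  obtain ⟨k, j⟩ := ω
  cases j
  · rw [shortWealth_shadow_false]
    linarith [shortSale_pos hn k]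
  · rw [shortWealth_shadow_true]
    positivity

lemma lintegral_P_ne_top {n : ℕ} {f : Omega → ℝ≥0∞}
    (h : ∀ k, q n k * f (k, true) + (1 - q n k) * f (k, false) ≤ 1) :
    ∫⁻ ω, f ω ∂(P n) ≠ ∞ := by
  rw [lintegral_P]
  refine ne_top_of_le_ne_top (tsum_pk_ne_top n) (ENNReal.tsum_le_tsum fun k => ?_)
  exact mul_le_of_le_one_right' (h k)

lemma lintegral_posPart_ne_top {n : ℕ} (hn : 2 ≤ n) :
    ∫⁻ ω, ENNReal.ofReal (Real.log (shortWealth n shadow ω)) ∂(P n) ≠ ∞ := by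
  refine lintegral_P_ne_top fun k => ?_
  have h0 : ENNReal.ofReal (Real.log (shortWealth n shadow (k, true))) = 0 := by
    rw [shortWealth_shadow_true, ENNReal.ofReal_eq_zero]
    exact Real.log_nonpos (by positivity) (inv_two_pow_mul_lt_one hn k).le
  have h1 : ENNReal.ofReal (Real.log (shortWealth n shadow (k, false))) ≤ 1 := by
    rw [ENNReal.ofReal_le_one]
    have := Real.log_le_sub_one_of_pos (shortWealth_shadow_pos hn (k, false))
    rw [shortWealth_shadow_false] at this ⊢
    linarith [shortSale_le_one n k]
  rw [h0, mul_zero, zero_add]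
  exact mul_le_one' tsub_le_self h1

lemma lintegral_negPart_ne_top {n : ℕ} (hn : 2 ≤ n) :
    ∫⁻ ω, ENNReal.ofReal (-Real.log (shortWealth n shadow ω)) ∂(P n) ≠ ∞ := by
  refine lintegral_P_ne_top fun k => ?_
  have h0 : ENNReal.ofReal (-Real.log (shortWealth n shadow (k, false))) = 0 := by
    rw [shortWealth_shadow_false, ENNReal.ofReal_eq_zero, neg_nonpos]
    exact Real.log_nonneg (by linarith [shortSale_pos hn k])
  rw [h0, mul_zero, add_zero, q_eq_ofReal, ← ENNReal.ofReal_mul (by positivity),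
    ENNReal.ofReal_le_one, shortWealth_shadow_true, ← Real.log_inv]
  set r : ℝ := (2 : ℝ)⁻¹ ^ (n + k) with hr
  have hr0 : 0 < r := by positivity
  have hlog := Real.log_le_sub_one_of_pos (x := (r * (2 + k))⁻¹) (by positivity)
  calc r * Real.log (r * (2 + k))⁻¹ ≤ r * (r * (2 + k))⁻¹ := by gcongr; linarith
    _ = (2 + k : ℝ)⁻¹ := by field_simp
    _ ≤ 1 := inv_le_one_of_one_le₀ (by linarith [(Nat.cast_nonneg k : (0 : ℝ) ≤ k)])

/-- Trading at the ask price costs at least, and at the bid price yields at most, what trading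
the same amount at an intermediate price does. -/
lemma trade_le {x y bid ask s : ℝ} (hb : bid ≤ s) (ha : s ≤ ask) :
    -(max (x - y) 0) * ask + max (y - x) 0 * bid ≤ -(x - y) * s := by
  rcases le_total x y with h | h
  · rw [max_eq_right (by linarith), max_eq_left (by linarith)]
    nlinarith
  · rw [max_eq_left (by linarith), max_eq_right (by linarith)]
    nlinarith

/-- Wealth of an admissible strategy at time 2 bounded by valuing the time-1 portfolio. -/
lemma AdmissibleTC.a2_le {n : ℕ} {φ : Strat} (h : AdmissibleTC n φ) (k : ℕ) :
    φ.a2 (k, false) ≤ φ.a1 k + φ.b1 k ∧ φ.a2 (k, true) ≤ φ.a1 k + (3 + k) * φ.b1 k := by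
  obtain ⟨⟨-, -, h2⟩, hb, -⟩ := h
  have hk : (0 : ℝ) ≤ k := by positivity
  constructor
  · have h3 := (h2 (k, false)).trans (trade_le (s := 1) le_rfl (by simp [ask2]))
    rw [hb] at h3
    linarith
  · have h3 := (h2 (k, true)).trans (trade_le (s := 3 + k) (by linarith) (by simp [ask2]))
    rw [hb] at h3
    linarith

lemma AdmissibleTC.b0_nonneg {n : ℕ} (hn : 1 ≤ n) {φ : Strat} (h : AdmissibleTC n φ) :
    0 ≤ φ.b0 := by
  have hpos := (ae_P_iff hn _).1 h.2.2
  have h0 := h.1.1.trans (trade_le (s := 3) le_rfl le_rfl)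
  have key : ∀ k : ℕ, 0 < 1 + (k - 1) * φ.b0 := by
    intro k
    have hk : (0 : ℝ) ≤ k := by positivity
    have h1 := (h.1.2.1 k).trans (trade_le (s := 2 + k) (by linarith) (by simp [ask1]))
    obtain ⟨hf, ht⟩ := h.a2_le k
    have pf := hpos (k, false)
    have pt := hpos (k, true)
    have : 0 < (2 + k) * (φ.a1 k + (2 + k) * φ.b1 k) := by nlinarith
    have := pos_of_mul_pos_right this (by linarith)
    linarith
  by_contra! hneg
  obtain ⟨k, hk⟩ := exists_nat_gt (1 - 1 / φ.b0)
  have := key k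
  have h2 : (1 - 1 / φ.b0) * φ.b0 = φ.b0 - 1 := by field_simp [hneg.ne]
  nlinarith

/-- The supermartingale property of admissible wealth under the dual measure. -/
lemma AdmissibleTC.dual_le {n : ℕ} (hn : 1 ≤ n) {φ : Strat} (h : AdmissibleTC n φ) (k : ℕ) :
    (1 + k) * φ.a2 (k, false) + φ.a2 (k, true) ≤ 2 + k := by
  have hk : (0 : ℝ) ≤ k := by positivity
  have h0 := h.1.1.trans (trade_le (s := 3) le_rfl le_rfl)
  have h1 := (h.1.2.1 k).trans (trade_le (s := 2) le_rfl (by simp [ask1]))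
  obtain ⟨hf, ht⟩ := h.a2_le k
  have hb := h.b0_nonneg hn
  nlinarith

/-- Conditionally on the first coordinate, `shortWealth n shadow` is log-optimal. -/
lemma AdmissibleTC.log_le {n : ℕ} (hn : 2 ≤ n) {φ : Strat} (h : AdmissibleTC n φ) (k : ℕ) :
    (2 : ℝ)⁻¹ ^ (n + k) * Real.log (φ.a2 (k, true)) +
        (1 - (2 : ℝ)⁻¹ ^ (n + k)) * Real.log (φ.a2 (k, false)) ≤
      (2 : ℝ)⁻¹ ^ (n + k) * Real.log (shortWealth n shadow (k, true)) +
        (1 - (2 : ℝ)⁻¹ ^ (n + k)) * Real.log (shortWealth n shadow (k, false)) := by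
  have hpos := (ae_P_iff (by omega) _).1 h.2.2
  have hr1 := inv_two_pow_lt_one (n := n) (by omega) k
  have hd := h.dual_le (by omega) k
  have log_sub : ∀ ω, Real.log (φ.a2 ω) - Real.log (shortWealth n shadow ω) ≤
      φ.a2 ω / shortWealth n shadow ω - 1 := by
    intro ω
    rw [← Real.log_div (hpos ω).ne' (shortWealth_shadow_pos hn ω).ne']
    exact Real.log_le_sub_one_of_pos (div_pos (hpos ω) (shortWealth_shadow_pos hn ω))
  have ht := log_sub (k, true)
  have hf := log_sub (k, false)
  have hfV : shortWealth n shadow (k, false) =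
      (1 - (2 : ℝ)⁻¹ ^ (n + k)) * (2 + k) / (1 + k) := by
    rw [shortWealth_shadow_false, shortSale]
    field_simp
    ring
  have htV := shortWealth_shadow_true n k
  set r : ℝ := (2 : ℝ)⁻¹ ^ (n + k) with hr
  have hr0 : 0 < r := by positivity
  have hr1' : 0 < 1 - r := by linarith
  have e1 : r * (φ.a2 (k, true) / shortWealth n shadow (k, true)) = φ.a2 (k, true) / (2 + k) := by
    rw [htV]
    field_simp
  have e2 : (1 - r) * (φ.a2 (k, false) / shortWealth n shadow (k, false)) =
      (1 + k) * φ.a2 (k, false) / (2 + k) := by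
    rw [hfV]
    field_simp
  have e3 : φ.a2 (k, true) / (2 + k) + (1 + k) * φ.a2 (k, false) / (2 + k) ≤ 1 := by
    rw [← add_div, div_le_one (by positivity)]
    linarith
  have ht' := mul_le_mul_of_nonneg_left ht hr0.le
  have hf' := mul_le_mul_of_nonneg_left hf hr1'.le
  rw [mul_sub, mul_sub, e1] at ht'
  rw [mul_sub, mul_sub, e2] at hf'
  linarith

lemma ofReal_eq_ofReal_max (x : ℝ) : ENNReal.ofReal x = ENNReal.ofReal (max x 0) := by
  rw [ENNReal.ofReal_max, ENNReal.ofReal_zero, max_eq_left zero_le]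

/-- A convex-combination inequality between reals, split into positive and negative parts. -/
lemma ofReal_mul_add_le {r x y x' y' : ℝ} (hr0 : 0 ≤ r) (hr1 : r ≤ 1)
    (h : r * x + (1 - r) * y ≤ r * x' + (1 - r) * y') :
    (ENNReal.ofReal r * ENNReal.ofReal x + ENNReal.ofReal (1 - r) * ENNReal.ofReal y) +
        (ENNReal.ofReal r * ENNReal.ofReal (-x') +
          ENNReal.ofReal (1 - r) * ENNReal.ofReal (-y')) ≤
      (ENNReal.ofReal r * ENNReal.ofReal x' + ENNReal.ofReal (1 - r) * ENNReal.ofReal y') +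
        (ENNReal.ofReal r * ENNReal.ofReal (-x) +
          ENNReal.ofReal (1 - r) * ENNReal.ofReal (-y)) := by
  have hr1' : 0 ≤ 1 - r := by linarith
  have comb : ∀ u v : ℝ, ENNReal.ofReal r * ENNReal.ofReal u +
      ENNReal.ofReal (1 - r) * ENNReal.ofReal v =
      ENNReal.ofReal (r * max u 0 + (1 - r) * max v 0) := by
    intro u v
    rw [ENNReal.ofReal_add (by positivity) (by positivity), ENNReal.ofReal_mul hr0,
      ENNReal.ofReal_mul hr1', ← ofReal_eq_ofReal_max, ← ofReal_eq_ofReal_max]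
  rw [comb, comb, comb, comb, ← ENNReal.ofReal_add (by positivity) (by positivity),
    ← ENNReal.ofReal_add (by positivity) (by positivity)]
  apply ENNReal.ofReal_le_ofReal
  have hx := max_zero_sub_max_neg_zero_eq_self x
  have hy := max_zero_sub_max_neg_zero_eq_self y
  have hx' := max_zero_sub_max_neg_zero_eq_self x'
  have hy' := max_zero_sub_max_neg_zero_eq_self y'
  rw [← hx, ← hy, ← hx', ← hy'] at h
  linarith

lemma JTC_le {n : ℕ} (hn : 2 ≤ n) : JTC n ≤ elog (P n) (shortWealth n shadow) := by
  refine sSup_le ?_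
  rintro _ ⟨φ, h, rfl⟩
  rw [elog, elog, EReal.coe_sub_coe_le_iff _ _ (lintegral_posPart_ne_top hn)
    (lintegral_negPart_ne_top hn)]
  simp only [lintegral_P]
  rw [← ENNReal.tsum_add, ← ENNReal.tsum_add]
  refine ENNReal.tsum_le_tsum fun k => ?_
  rw [← mul_add, ← mul_add, one_sub_q_eq_ofReal, q_eq_ofReal]
  refine mul_le_mul_right ?_ _
  exact ofReal_mul_add_le (by positivity) (inv_two_pow_lt_one (by omega) k).le (h.log_le hn k)

lemma elog_shortWealth_le_JFL {n : ℕ} (hn : 1 ≤ n) (S : PriceProc)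
    (hpos : ∀ ω, 0 < shortWealth n S ω) (h0 : S.s0 = 3) :
    elog (P n) (shortWealth n S) ≤ JFL n S := by
  refine le_sSup ⟨⟨1, 0, fun k => 1 + shortSale n k * S.s1 k, fun k => -shortSale n k,
    shortWealth n S, fun _ => 0⟩, ⟨⟨?_, fun k => ?_, fun ω => ?_⟩, fun _ => rfl, ?_⟩, rfl⟩
  · simp only [h0]
    norm_num
  · ring
  · simp only [shortWealth]
    ring
  · exact (ae_P_iff hn _).2 hpos

lemma ofReal_add_ofReal_neg_lt {x y : ℝ} (h : x < y) :
    ENNReal.ofReal x + ENNReal.ofReal (-y) < ENNReal.ofReal y + ENNReal.ofReal (-x) := by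
  rw [ofReal_eq_ofReal_max x, ofReal_eq_ofReal_max y, ofReal_eq_ofReal_max (-x),
    ofReal_eq_ofReal_max (-y), ← ENNReal.ofReal_add (by positivity) (by positivity),
    ← ENNReal.ofReal_add (by positivity) (by positivity)]
  have hx := max_zero_sub_max_neg_zero_eq_self x
  have hy := max_zero_sub_max_neg_zero_eq_self y
  have hx' : 0 ≤ max x 0 := le_max_right _ _
  have hy' : 0 ≤ max (-y) 0 := le_max_right _ _
  exact (ENNReal.ofReal_lt_ofReal_iff (by linarith)).2 (by linarith)

/-- Expected log-utility is strictly increasing, from a wealth of finite expected log-utility. -/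
lemma elog_lt_elog {n : ℕ} (hn : 1 ≤ n) {f g : Omega → ℝ} (hf : ∀ ω, 0 < f ω)
    (hfg : ∀ ω, f ω ≤ g ω) {ω₀ : Omega} (hlt : f ω₀ < g ω₀)
    (hpos : ∫⁻ ω, ENNReal.ofReal (Real.log (f ω)) ∂(P n) ≠ ∞)
    (hneg : ∫⁻ ω, ENNReal.ofReal (-Real.log (f ω)) ∂(P n) ≠ ∞) :
    elog (P n) f < elog (P n) g := by
  have hlog : ∀ ω, Real.log (f ω) ≤ Real.log (g ω) := fun ω => Real.log_le_log (hf ω) (hfg ω)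
  rw [← not_le, elog, elog, EReal.coe_sub_coe_le_iff _ _ hpos hneg, not_le]
  have hneg' : ∫⁻ ω, ENNReal.ofReal (-Real.log (g ω)) ∂(P n) ≠ ∞ :=
    ne_top_of_le_ne_top hneg (lintegral_mono fun ω =>
      ENNReal.ofReal_le_ofReal (neg_le_neg (hlog ω)))
  have hm : ∀ u : Omega → ℝ≥0∞, Measurable u := fun u => Measurable.of_discrete
  have hfin := ENNReal.add_ne_top.2 ⟨hpos, hneg'⟩
  rw [← lintegral_add_left (hm _)] at hfin
  rw [← lintegral_add_left (hm _), ← lintegral_add_left (hm _)]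
  refine lintegral_strict_mono_of_ae_le_of_frequently_ae_lt (hm _).aemeasurable hfin
    (ae_of_all _ fun ω => ?_) fun h => ?_
  · exact add_le_add (ENNReal.ofReal_le_ofReal (hlog ω))
      (ENNReal.ofReal_le_ofReal (neg_le_neg (hlog ω)))
  · exact (ae_P_iff hn _).1 h ω₀ (ofReal_add_ofReal_neg_lt (Real.log_lt_log (hf ω₀) hlt)).ne

/-- The short sale yields at least as much at any price process in the spread as at `shadow`. -/
lemma shortWealth_shadow_le {n : ℕ} (hn : 2 ≤ n) {S : PriceProc} (hS : SpreadValued S)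
    (ω : Omega) : shortWealth n shadow ω ≤ shortWealth n S ω := by
  have h1 := (hS.2.1 ω.1).1
  have h2 := (hS.2.2 ω).2
  have := mul_le_mul_of_nonneg_left (by linarith : 2 - ask2 ω ≤ S.s1 ω.1 - S.s2 ω)
    (shortSale_pos hn ω.1).le
  simp only [shortWealth, shadow]
  linarith

/-- for all sufficiently large `n`, every spread-valued adapted process `S̃`
with `J(S̃) = J` must satisfy `S̃_0 = 3`, `S̃_1 = 2` a.s. and `S̃_2 = S̄_2` a.s. -/
theorem stmt_2 :
    ∃ n₀ : ℕ, ∀ n : ℕ, n₀ ≤ n →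
      ∀ S : PriceProc, SpreadValued S → JFL n S = JTC n →
        S.s0 = 3 ∧ (∀ k : ℕ, S.s1 k = 2) ∧ (∀ ω : Omega, S.s2 ω = ask2 ω) := by
  refine ⟨2, fun n hn S hS hJ => ?_⟩
  have heq : ∀ ω, shortWealth n S ω = shortWealth n shadow ω := by
    by_contra! hne
    obtain ⟨ω, hω⟩ := hne
    have hle := shortWealth_shadow_le hn hS
    have hlt := elog_lt_elog (by omega) (shortWealth_shadow_pos hn) hle
      (lt_of_le_of_ne (hle ω) hω.symm) (lintegral_posPart_ne_top hn) (lintegral_negPart_ne_top hn)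
    have hFL := elog_shortWealth_le_JFL (by omega) S
      (fun ω => (shortWealth_shadow_pos hn ω).trans_le (hle ω)) hS.1
    exact absurd hJ (((JTC_le hn).trans_lt hlt).trans_le hFL).ne'
  have hdiff : ∀ ω : Omega, S.s1 ω.1 - S.s2 ω = 2 - ask2 ω := by
    intro ω
    have h := heq ω
    simp only [shortWealth, shadow] at h
    exact mul_left_cancel₀ (shortSale_pos hn ω.1).ne' (by linarith)
  refine ⟨hS.1, fun k => ?_, fun ω => ?_⟩
  · linarith [hdiff (k, true), (hS.2.1 k).1, (hS.2.2 (k, true)).2]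
  · linarith [hdiff ω, (hS.2.1 ω.1).1, (hS.2.2 ω).2]
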